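/- arXiv:2006.05442 — 2 statements merged into one kernel-verified Lean document; each statement's English description precedes it below -/
import Mathlib

section
/- Let n ≥ 1 and let r_0, r_1, …, r_{n-1} be positive naturals. For j = 1,…,n and indices (k, k') ∈ Fin r_{j-1} × Fin r_j (with Fin r_n identified with Fin r_0), let a^{(j)}_{k,k'} be real-valued random variables on a common probability space such that the whole family { a^{(j)}_{k,k'} } (over all j, k, k') is jointly independent, each with mean 0 and variance σ². Define w = ∑_{k_0 ∈ Fin r_0} ∑_{k_1 ∈ Fin r_1} ⋯ ∑_{k_{n-1} ∈ Fin r_{n-1}} a^{(1)}_{k_0,k_1} · a^{(2)}_{k_1,k_2} ⋯ a^{(n)}_{k_{n-1},k_0}. Then E[w] = 0 and Var(w) = σ^{2n} · ∏_{k=0}^{n-1} r_k. -/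
open MeasureTheory ProbabilityTheory

/-- **Mean and variance of a tensor-train weight.**
Let `a⁽ʲ⁾_{k,k'}` (for `j = 1,…,n`, `k ∈ Fin r_{j-1}`, `k' ∈ Fin r_j`, with
`Fin rₙ` identified with `Fin r₀` cyclically) be a jointly independent family
of square-integrable real random variables, each with mean `0` and variance
`σ²`.  Then the closed tensor-train contraction
`w = ∑_{k₀,…,k_{n-1}} a⁽¹⁾_{k₀,k₁} a⁽²⁾_{k₁,k₂} ⋯ a⁽ⁿ⁾_{k_{n-1},k₀}`
has mean `0` and variance `σ^{2n} ∏_{k=0}^{n-1} r_k`. -/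
theorem tensor_train_weight_mean_variance
    {Ω : Type*} [MeasurableSpace Ω] (μ : Measure Ω) [IsProbabilityMeasure μ]
    (n : ℕ) [NeZero n] (hn : 1 ≤ n) (r : Fin n → ℕ) (hr : ∀ k, 0 < r k)
    (a : ∀ j : Fin n, Fin (r j) → Fin (r (j + 1)) → Ω → ℝ)
    (σ : ℝ)
    (hindep : iIndepFun
      (fun p : Σ j : Fin n, Fin (r j) × Fin (r (j + 1)) => a p.1 p.2.1 p.2.2) μ)
    (hL2 : ∀ j k k', MemLp (a j k k') 2 μ)
    (hmean : ∀ j k k', μ[a j k k'] = 0)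
    (hvar : ∀ j k k', variance (a j k k') μ = σ ^ 2)
    (w : Ω → ℝ)
    (hw : w = fun ω => ∑ k : ∀ j : Fin n, Fin (r j),
      ∏ j : Fin n, a j (k j) (k (j + 1)) ω) :
    μ[w] = 0 ∧ variance w μ = σ ^ (2 * n) * ∏ k : Fin n, (r k : ℝ) := by
  classical
  let S := Σ j : Fin n, Fin (r j) × Fin (r (j + 1))
  let X : S → Ω → ℝ := fun p => a p.1 p.2.1 p.2.2
  have hX : iIndepFun X μ := hindep
  have hXL : ∀ p, MemLp (X p) 2 μ := fun p => hL2 _ _ _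
  have hXm : ∀ p, ∫ ω, X p ω ∂μ = 0 := fun p => hmean _ _ _
  have hXv : ∀ p, ∫ ω, X p ω * X p ω ∂μ = σ ^ 2 := by
    intro p
    have h := hvar p.1 p.2.1 p.2.2
    rw [variance_of_integral_eq_zero (hL2 _ _ _).aemeasurable (hmean _ _ _)] at h
    rw [← h]
    exact integral_congr_ae (Filter.Eventually.of_forall fun ω => (sq (X p ω)).symm)
  let e : (∀ j : Fin n, Fin (r j)) → Fin n → S := fun k j => ⟨j, k j, k (j + 1)⟩
  have he : ∀ k, Function.Injective (e k) := fun k i j h => congrArg Sigma.fst h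
  let P : (∀ j : Fin n, Fin (r j)) → Ω → ℝ := fun k ω => ∏ j, X (e k j) ω
  have hY : ∀ k, iIndepFun (fun j => X (e k j)) μ := fun k => hX.precomp (he k)
  have hPm : ∀ k, ∫ ω, P k ω ∂μ = 0 := by
    intro k
    have h := (hY k).integral_fun_prod_eq_prod_integral (fun j => (hXL _).aestronglyMeasurable)
    refine h.trans ?_
    exact Finset.prod_eq_zero (Finset.mem_univ (0 : Fin n)) (hXm _)
  have hPL : ∀ k, MemLp (P k) 2 μ := by
    intro k
    have hmeas : AEStronglyMeasurable (P k) μ :=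
      Finset.aestronglyMeasurable_fun_prod Finset.univ
        fun j _ => (hXL (e k j)).aestronglyMeasurable
    rw [memLp_two_iff_integrable_sq hmeas]
    have hae : ∀ j, AEMeasurable (X (e k j)) μ := fun j => (hXL _).aemeasurable
    have hpi := (hY k).map_fun_eq_pi_map hae
    have hint : Integrable (fun x : Fin n → ℝ => ∏ j, (x j) ^ 2)
        (Measure.pi fun j => μ.map (X (e k j))) := by
      have : ∀ j, IsProbabilityMeasure (μ.map (X (e k j))) :=
        fun j => Measure.isProbabilityMeasure_map (hae j)
      refine Integrable.fintype_prod_dep (f := fun _ x => x ^ 2) fun j => ?_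
      rw [integrable_map_measure (by fun_prop) (hae j)]
      exact (hXL (e k j)).integrable_sq
    rw [← hpi, integrable_map_measure (Continuous.aestronglyMeasurable (by fun_prop)) (by fun_prop)] at hint
    refine hint.congr (Filter.Eventually.of_forall fun ω => ?_)
    simp [P, Finset.prod_pow]
  have hsel : ∀ k (g : S → ℝ),
      ∏ j, g (e k j) = ∏ p, if p ∈ Finset.univ.image (e k) then g p else 1 := by
    intro k g
    rw [Finset.prod_ite_mem, Finset.univ_inter, Finset.prod_image (fun i _ j _ h => he k h)]
  have hPP : ∀ k l, ∫ ω, P k ω * P l ω ∂μ = if k = l then σ ^ (2 * n) else 0 := by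
    intro k l
    split_ifs with hkl
    · subst hkl
      have h := (hY k).integral_fun_prod_comp (f := fun _ x => x * x)
        (fun j => (hXL _).aemeasurable) (fun j => by fun_prop)
      simp only [P, ← Finset.prod_mul_distrib]
      rw [h]
      simp [hXv, ← pow_mul]
    · obtain ⟨j, hj⟩ := Function.ne_iff.mp hkl
      have h := hX.integral_fun_prod_comp
        (f := fun p x => (if p ∈ Finset.univ.image (e k) then x else 1) *
          (if p ∈ Finset.univ.image (e l) then x else 1))
        (fun p => (hXL _).aemeasurable)
        (fun p => by split_ifs <;> fun_prop)
      have h1 : ∀ ω, P k ω * P l ω = ∏ p, ((if p ∈ Finset.univ.image (e k) then X p ω else 1) *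
          (if p ∈ Finset.univ.image (e l) then X p ω else 1)) := by
        intro ω
        rw [Finset.prod_mul_distrib, ← hsel k (fun p => X p ω), ← hsel l (fun p => X p ω)]
      simp_rw [h1]
      rw [h]
      refine Finset.prod_eq_zero (Finset.mem_univ (e k j)) ?_
      have m1 : e k j ∈ Finset.univ.image (e k) := Finset.mem_image_of_mem _ (Finset.mem_univ _)
      have m2 : e k j ∉ Finset.univ.image (e l) := by
        intro hm
        obtain ⟨i, -, hi⟩ := Finset.mem_image.mp hm
        obtain rfl : i = j := congrArg Sigma.fst hi
        have h2 := eq_of_heq (Sigma.mk.inj hi).2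
        exact hj (congrArg Prod.fst h2).symm
      simp only [m1, m2, if_true, if_false, mul_one]
      exact hXm _
  have hw' : w = fun ω => ∑ k, P k ω := hw
  have hwm : ∫ ω, w ω ∂μ = 0 := by
    rw [hw', integral_finsetSum _ fun k _ => (hPL k).integrable one_le_two]
    exact Finset.sum_eq_zero fun k _ => hPm k
  refine ⟨hwm, ?_⟩
  have hwL : MemLp w 2 μ := by
    rw [hw']
    exact memLp_finsetSum _ fun k _ => hPL k
  rw [variance_of_integral_eq_zero hwL.aemeasurable hwm]
  have h2 : ∀ ω, w ω ^ 2 = ∑ k, ∑ l, P k ω * P l ω := by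
    intro ω
    rw [hw', sq, Finset.sum_mul_sum]
  have hi : ∀ k l, Integrable (fun ω => P k ω * P l ω) μ :=
    fun k l => (hPL k).integrable_mul (hPL l)
  simp only [h2]
  rw [integral_finsetSum _ fun k _ => integrable_finsetSum _ fun l _ => hi k l]
  simp_rw [integral_finsetSum _ fun l _ => hi _ l, hPP]
  simp [mul_comm]
end

section
/- Let n ≥ 1 and let r_0, r_1, …, r_{n-1} be positive naturals. For j = 1,…,n and (k,k') ∈ Fin r_{j-1} × Fin r_j (with Fin r_n identified with Fin r_0), let a^{(j)}_{k,k'} be real-valued random variables on a common probability space such that the whole family { a^{(j)}_{k,k'} } is jointly independent and each variable has mean 0. Let κ = (k_0,…,k_{n-1}) and κ' = (k'_0,…,k'_{n-1}) be two distinct index tuples in Fin r_0 × ⋯ × Fin r_{n-1}, and assume all the random variables are integrable together with the relevant products. Then E[ (a^{(1)}_{k_0,k_1} ⋯ a^{(n)}_{k_{n-1},k_0}) · (a^{(1)}_{k'_0,k'_1} ⋯ a^{(n)}_{k'_{n-1},k'_0}) ] = 0. -/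
open MeasureTheory ProbabilityTheory

/-- **Cross-term lemma for tensor-train weights.**
Let `a⁽ʲ⁾_{k,k'}` (for `j = 1,…,n`, `k ∈ Fin r_{j-1}`, `k' ∈ Fin r_j`, with
`Fin rₙ` identified with `Fin r₀` cyclically) be a jointly independent family
of real random variables with mean `0`, integrable together with the relevant
products.  If `κ ≠ κ'` are two distinct index tuples, then the two closed
tensor-train summands `a⁽¹⁾_{k₀,k₁} ⋯ a⁽ⁿ⁾_{k_{n-1},k₀}` and
`a⁽¹⁾_{k'₀,k'₁} ⋯ a⁽ⁿ⁾_{k'_{n-1},k'₀}` are uncorrelated: the expectation of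
their product vanishes. -/
theorem tensor_train_cross_term_vanishes
    {Ω : Type*} [MeasurableSpace Ω] (μ : Measure Ω) [IsProbabilityMeasure μ]
    (n : ℕ) [NeZero n] (hn : 1 ≤ n) (r : Fin n → ℕ) (hr : ∀ k, 0 < r k)
    (a : ∀ j : Fin n, Fin (r j) → Fin (r (j + 1)) → Ω → ℝ)
    (hindep : iIndepFun
      (fun p : Σ j : Fin n, Fin (r j) × Fin (r (j + 1)) => a p.1 p.2.1 p.2.2) μ)
    (hmean : ∀ j k k', μ[a j k k'] = 0)
    (hint : ∀ j k k', Integrable (a j k k') μ)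
    (hint2 : ∀ j k k', Integrable (fun ω => a j k k' ω * a j k k' ω) μ)
    (κ κ' : ∀ j : Fin n, Fin (r j)) (hκ : κ ≠ κ')
    (hintprod : Integrable
      (fun ω => (∏ j : Fin n, a j (κ j) (κ (j + 1)) ω) *
        (∏ j : Fin n, a j (κ' j) (κ' (j + 1)) ω)) μ) :
    μ[fun ω => (∏ j : Fin n, a j (κ j) (κ (j + 1)) ω) *
        (∏ j : Fin n, a j (κ' j) (κ' (j + 1)) ω)] = 0 := by
  obtain ⟨i, hi⟩ := Function.ne_iff.mp hκ
  classical
  let X : (Σ j : Fin n, Fin (r j) × Fin (r (j + 1))) → Ω → ℝ := fun p => a p.1 p.2.1 p.2.2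
  let F : (∀ j : Fin n, Fin (r j)) → (Σ j : Fin n, Fin (r j) × Fin (r (j + 1))) → ℝ → ℝ :=
    fun σ p x => if p.2 = (σ p.1, σ (p.1 + 1)) then x else 1
  have hF : ∀ σ p, Measurable (F σ p) := by
    intro σ p
    by_cases h : p.2 = (σ p.1, σ (p.1 + 1))
    · simp only [F, if_pos h]; exact measurable_id
    · simp only [F, if_neg h]; exact measurable_const
  have hprod : ∀ σ : (∀ j : Fin n, Fin (r j)), ∀ ω,
      (∏ j : Fin n, a j (σ j) (σ (j + 1)) ω) = ∏ p, F σ p (X p ω) := by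
    intro σ ω
    rw [Fintype.prod_sigma]
    refine Finset.prod_congr rfl fun j _ => ?_
    simp only [F, X]
    rw [Finset.prod_ite_eq' Finset.univ (σ j, σ (j + 1)) (fun q => a j q.1 q.2 ω)]
    simp
  have hXm : ∀ p, AEMeasurable (X p) μ := fun p => (hint _ _ _).aemeasurable
  have key := iIndepFun.integral_fun_prod_comp (X := X)
    (f := fun p x => F κ p x * F κ' p x) hindep hXm
    (fun p => ((hF κ p).mul (hF κ' p)).aestronglyMeasurable)
  simp only [hprod, ← Finset.prod_mul_distrib]
  rw [key]
  refine Finset.prod_eq_zero (Finset.mem_univ ⟨i, (κ i, κ (i + 1))⟩) ?_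
  have h1 : ¬ ((κ i, κ (i + 1)) = (κ' i, κ' (i + 1))) := fun h => hi (Prod.ext_iff.mp h).1
  simp only [F, X, if_neg h1, if_true, mul_one]
  exact hmean _ _ _
end
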